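/- arXiv:1208.5224 — 5 statements merged into one kernel-verified Lean document; each statement's English description precedes it below -/
import Mathlib

section
/- Let μ be a finite Borel measure on ℝ with Borel transform F, and let μ_ac be the absolutely continuous part of μ in its Lebesgue decomposition with respect to Lebesgue measure. Then supp μ_ac = clac({x ∈ ℝ : the limit Im F(x+i0) := lim_{y↘0} Im F(x+iy) exists and satisfies 0 < Im F(x+i0) < +∞}). -/
open MeasureTheory Filter Complex Set

/-- The Borel transform of a measure on `ℝ`. -/
noncomputable def borelTransform (μ : Measure ℝ) (z : ℂ) : ℂ :=
  ∫ t : ℝ, (1 : ℂ) / ((t : ℂ) - z) ∂μ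

/-- The set of growth points (support) of a Borel measure on `ℝ`. -/
def msupp (ν : Measure ℝ) : Set ℝ :=
  {x : ℝ | ∀ ε : ℝ, 0 < ε → 0 < ν (Set.Ioo (x - ε) (x + ε))}

/-- The absolutely continuous (essential) closure of a set of reals. -/
def clac (χ : Set ℝ) : Set ℝ :=
  {x : ℝ | ∀ ε : ℝ, 0 < ε → 0 < volume (Set.Ioo (x - ε) (x + ε) ∩ χ)}

/-- The tail integral of the kernel `2u / (1 + u²)²` over `(a, ∞)` is `1 / (1 + a²)`. -/
theorem integrableOn_and_integral_kernel {a : ℝ} (ha : 0 ≤ a) :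
    IntegrableOn (fun u : ℝ => 2 * u / (1 + u ^ 2) ^ 2) (Ioi a) ∧
      ∫ u in Ioi a, 2 * u / (1 + u ^ 2) ^ 2 = 1 / (1 + a ^ 2) := by
  have hderiv : ∀ u : ℝ,
      HasDerivAt (fun u : ℝ => -(1 + u ^ 2)⁻¹) (2 * u / (1 + u ^ 2) ^ 2) u := fun u => by
    have h0 : (1 + u ^ 2 : ℝ) ≠ 0 := by positivity
    have h := (((hasDerivAt_pow 2 u).const_add 1).inv h0).neg
    exact h.congr_deriv (by push_cast; ring)
  have hlim : Tendsto (fun u : ℝ => -(1 + u ^ 2)⁻¹) atTop (nhds 0) := by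
    have h : Tendsto (fun u : ℝ => (1 + u ^ 2)⁻¹) atTop (nhds 0) :=
      (tendsto_atTop_add_const_left _ _ (tendsto_pow_atTop two_ne_zero)).inv_tendsto_atTop
    simpa using h.neg
  have hpos : ∀ u ∈ Ioi a, 0 ≤ 2 * u / (1 + u ^ 2) ^ 2 := fun u hu => by
    have : 0 ≤ u := ha.trans (le_of_lt hu)
    positivity
  refine ⟨integrableOn_Ioi_deriv_of_nonneg' (fun u _ => hderiv u) hpos hlim, ?_⟩
  rw [integral_Ioi_of_hasDerivAt_of_nonneg' (fun u _ => hderiv u) hpos hlim]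
  simp

/-- The imaginary part of the Borel transform is the Poisson-type integral of the measure. -/
theorem borelTransform_im (μ : Measure ℝ) [IsFiniteMeasure μ] (x : ℝ) {y : ℝ} (hy : 0 < y) :
    (borelTransform μ ((x : ℂ) + y * Complex.I)).im =
      ∫ t : ℝ, y⁻¹ * (1 / (1 + (|t - x| / y) ^ 2)) ∂μ := by
  have him : ∀ t : ℝ, ((t : ℂ) - (x + y * Complex.I)).im = -y := fun t => by simp
  have hne : ∀ t : ℝ, (t : ℂ) - (x + y * Complex.I) ≠ 0 := fun t h => by
    have := him t
    rw [h] at this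
    simp at this
    exact hy.ne' this
  have hint : Integrable (fun t : ℝ => (1 : ℂ) / ((t : ℂ) - (x + y * Complex.I))) μ := by
    refine Integrable.of_bound (C := y⁻¹) ?_ (Eventually.of_forall fun t => ?_)
    · exact (continuous_const.div (by fun_prop) hne).aestronglyMeasurable
    · rw [norm_div, norm_one, one_div]
      refine inv_anti₀ hy ?_
      have := Complex.abs_im_le_norm ((t : ℂ) - (x + y * Complex.I))
      rwa [him, abs_neg, abs_of_pos hy] at this
  have h := integral_im hint
  rw [borelTransform]
  refine h.symm.trans (integral_congr_ae (Eventually.of_forall fun t => ?_))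
  have hre : ((t : ℂ) - (x + y * Complex.I)).re = t - x := by simp
  have hden : (t - x) ^ 2 + y ^ 2 ≠ 0 := by positivity
  change ((1 : ℂ) / ((t : ℂ) - (x + y * Complex.I))).im =
    y⁻¹ * (1 / (1 + (|t - x| / y) ^ 2))
  rw [one_div, Complex.inv_im, Complex.normSq_apply, him, hre, div_pow, sq_abs]
  field_simp
  ring

/-- Layer-cake representation of the imaginary part of the Borel transform in terms of the
measures of balls. -/
theorem borelTransform_im_eq_integral_closedBall (μ : Measure ℝ) [IsFiniteMeasure μ] (x : ℝ)
    {y : ℝ} (hy : 0 < y) :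
    (borelTransform μ ((x : ℂ) + y * Complex.I)).im =
      ∫ u in Ioi (0 : ℝ), y⁻¹ * (μ.real (Metric.closedBall x (y * u)) *
        (2 * u / (1 + u ^ 2) ^ 2)) := by
  rw [borelTransform_im μ x hy, integral_const_mul, integral_const_mul]
  congr 1
  set g : ℝ → ℝ := fun u => 2 * u / (1 + u ^ 2) ^ 2
  set S : Set (ℝ × ℝ) := {p | |p.1 - x| ≤ y * p.2} with hS
  have hSm : MeasurableSet S := measurableSet_le (by fun_prop) (by fun_prop)
  have hgi : IntegrableOn g (Ioi 0) := (integrableOn_and_integral_kernel le_rfl).1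
  have hint : Integrable (S.indicator fun p : ℝ × ℝ => g p.2)
      (μ.prod (volume.restrict (Ioi 0))) :=
    (hgi.integrable.comp_snd μ).indicator hSm
  have hleft : ∀ t : ℝ, 1 / (1 + (|t - x| / y) ^ 2) =
      ∫ u in Ioi (0 : ℝ), S.indicator (fun p : ℝ × ℝ => g p.2) (t, u) := fun t => by
    have ha : 0 ≤ |t - x| / y := by positivity
    rw [← (integrableOn_and_integral_kernel ha).2, ← integral_Ici_eq_integral_Ioi,
      ← integral_Ici_eq_integral_Ioi]
    have hsub : Ici (|t - x| / y) ⊆ Ici 0 := Ici_subset_Ici.2 ha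
    have : ∀ u, S.indicator (fun p : ℝ × ℝ => g p.2) (t, u) =
        (Ici (|t - x| / y)).indicator g u := fun u => by
      simp only [indicator, hS, mem_ofPred_eq, mem_Ici, div_le_iff₀' hy]
    simp_rw [this]
    rw [setIntegral_indicator measurableSet_Ici, inter_eq_right.2 hsub]
  simp_rw [hleft]
  rw [integral_integral_swap (f := fun t u => S.indicator (fun p : ℝ × ℝ => g p.2) (t, u)) hint]
  refine integral_congr_ae (Eventually.of_forall fun u => ?_)
  have : ∀ t, S.indicator (fun p : ℝ × ℝ => g p.2) (t, u) =
      (Metric.closedBall x (y * u)).indicator (fun _ => g u) t := fun t => by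
    simp only [indicator, hS, mem_ofPred_eq, Metric.mem_closedBall, Real.dist_eq]
  simp_rw [this]
  rw [integral_indicator_const _ Metric.isClosed_closedBall.measurableSet, smul_eq_mul]

/-- The kernel obtained by averaging the layer-cake representation over symmetric intervals is
integrable. -/
theorem integrableOn_sq_div_one_add_sq_sq :
    IntegrableOn (fun u : ℝ => 4 * u ^ 2 / (1 + u ^ 2) ^ 2) (Ioi 0) := by
  refine Integrable.mono' ((integrable_inv_one_add_sq.const_mul 4).integrableOn)
    (Continuous.aestronglyMeasurable
      (Continuous.div (by fun_prop) (by fun_prop) fun u => by positivity))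
    (Eventually.of_forall fun u => ?_)
  rw [Real.norm_of_nonneg (by positivity), div_le_iff₀ (by positivity)]
  have h : (1 + u ^ 2 : ℝ) ≠ 0 := by positivity
  have : 4 * (1 + u ^ 2)⁻¹ * (1 + u ^ 2) ^ 2 = 4 * (1 + u ^ 2) := by field_simp
  rw [this]
  linarith

theorem integral_sq_div_one_add_sq_sq_pos :
    0 < ∫ u in Ioi (0 : ℝ), 4 * u ^ 2 / (1 + u ^ 2) ^ 2 := by
  rw [setIntegral_pos_iff_support_of_nonneg_ae (Eventually.of_forall fun u => by
    dsimp; positivity) integrableOn_sq_div_one_add_sq_sq]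
  have : Ioi (0 : ℝ) ⊆ Function.support (fun u : ℝ => 4 * u ^ 2 / (1 + u ^ 2) ^ 2) ∩ Ioi 0 :=
    fun u hu => ⟨by
      have hu : 0 < u := hu
      rw [Function.mem_support]
      positivity, hu⟩
  exact lt_of_lt_of_le (by simp) (measure_mono this)

/-- If the symmetric derivative of `μ` at `x` exists, then so does the boundary value of the
imaginary part of its Borel transform, and the two are proportional. -/
theorem tendsto_borelTransform_im (μ : Measure ℝ) [IsFiniteMeasure μ] {x D : ℝ}
    (hD : Tendsto (fun r : ℝ => μ.real (Metric.closedBall x r) / (2 * r))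
      (nhdsWithin 0 (Ioi 0)) (nhds D)) :
    Tendsto (fun y : ℝ => (borelTransform μ ((x : ℂ) + y * Complex.I)).im)
      (nhdsWithin 0 (Ioi 0))
      (nhds (D * ∫ u in Ioi (0 : ℝ), 4 * u ^ 2 / (1 + u ^ 2) ^ 2)) := by
  obtain ⟨B, hB⟩ : ∃ B : ℝ, ∀ r : ℝ, 0 < r → μ.real (Metric.closedBall x r) / (2 * r) ≤ B := by
    have hev := hD.eventually (gt_mem_nhds (lt_add_one D))
    obtain ⟨δ, hδ, hδ'⟩ := mem_nhdsGT_iff_exists_Ioo_subset.1 hev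
    have hδ : 0 < δ := hδ
    refine ⟨max (D + 1) (μ.real univ / (2 * δ)), fun r hr => ?_⟩
    rcases lt_or_ge r δ with h | h
    · exact le_max_of_le_left (le_of_lt (hδ' ⟨hr, h⟩))
    · refine le_max_of_le_right ?_
      gcongr
      · exact measure_ne_top _ _
      · exact subset_univ _
  rw [← integral_const_mul]
  have heq : (fun y : ℝ => ∫ u in Ioi (0 : ℝ),
      μ.real (Metric.closedBall x (y * u)) / (2 * (y * u)) *
        (4 * u ^ 2 / (1 + u ^ 2) ^ 2)) =ᶠ[nhdsWithin 0 (Ioi 0)]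
      fun y : ℝ => (borelTransform μ ((x : ℂ) + y * Complex.I)).im := by
    filter_upwards [self_mem_nhdsWithin] with y hy
    have hy : 0 < y := hy
    rw [borelTransform_im_eq_integral_closedBall μ x hy]
    refine setIntegral_congr_fun measurableSet_Ioi fun u hu => ?_
    have hu : 0 < u := hu
    have h : (1 + u ^ 2 : ℝ) ≠ 0 := by positivity
    field_simp
    ring
  refine Tendsto.congr' heq ?_
  refine tendsto_integral_filter_of_dominated_convergence
    (fun u => B * (4 * u ^ 2 / (1 + u ^ 2) ^ 2)) ?_ ?_
    (integrableOn_sq_div_one_add_sq_sq.const_mul B) ?_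
  · filter_upwards [self_mem_nhdsWithin] with y hy
    have hy : 0 < y := hy
    have hmono : Monotone fun u : ℝ => μ.real (Metric.closedBall x (y * u)) := fun u v huv =>
      measureReal_mono (Metric.closedBall_subset_closedBall (by gcongr))
    have hm := hmono.measurable
    exact ((hm.div (by fun_prop)).mul (by fun_prop)).aestronglyMeasurable
  · filter_upwards [self_mem_nhdsWithin] with y hy
    have hy : 0 < y := hy
    filter_upwards [ae_restrict_mem measurableSet_Ioi] with u hu
    have hu : 0 < u := hu
    rw [Real.norm_of_nonneg (by positivity)]
    gcongr
    exact hB _ (mul_pos hy hu)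
  · filter_upwards [ae_restrict_mem measurableSet_Ioi] with u hu
    have hu : 0 < u := hu
    refine Tendsto.mul_const _ (hD.comp ?_)
    refine tendsto_nhdsWithin_iff.2 ⟨?_, ?_⟩
    · have : Tendsto (fun y : ℝ => y * u) (nhds 0) (nhds (0 * u)) :=
        (continuous_id.mul continuous_const).tendsto 0
      rw [zero_mul] at this
      exact this.mono_left nhdsWithin_le_nhds
    · filter_upwards [self_mem_nhdsWithin] with y hy
      exact mul_pos hy hu

/-- Lebesgue-almost everywhere, the boundary value of the imaginary part of the Borel transform
exists and is positive exactly where the density of `μ` is nonzero. -/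
theorem ae_exists_pos_tendsto_borelTransform_im_iff (μ : Measure ℝ) [IsFiniteMeasure μ] :
    ∀ᵐ x : ℝ, (∃ L : ℝ, 0 < L ∧
        Tendsto (fun y : ℝ => (borelTransform μ ((x : ℂ) + y * Complex.I)).im)
          (nhdsWithin 0 (Set.Ioi 0)) (nhds L)) ↔ μ.rnDeriv volume x ≠ 0 := by
  filter_upwards [Besicovitch.ae_tendsto_rnDeriv μ volume, μ.rnDeriv_lt_top volume] with x hx hfin
  have hD : Tendsto (fun r : ℝ => μ.real (Metric.closedBall x r) / (2 * r))
      (nhdsWithin 0 (Ioi 0)) (nhds (μ.rnDeriv volume x).toReal) := by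
    refine Tendsto.congr' ?_ ((ENNReal.tendsto_toReal hfin.ne).comp hx)
    filter_upwards [self_mem_nhdsWithin] with r hr
    have hr : 0 < r := hr
    simp [Measure.real, Real.volume_closedBall, ENNReal.toReal_div, hr.le]
  have hlim := tendsto_borelTransform_im μ hD
  have hC := integral_sq_div_one_add_sq_sq_pos
  constructor
  · rintro ⟨L, hL, hLt⟩ h0
    rw [h0, ENNReal.toReal_zero, zero_mul] at hlim
    exact hL.ne' (tendsto_nhds_unique hLt hlim)
  · exact fun h0 => ⟨_, mul_pos (ENNReal.toReal_pos h0 hfin.ne) hC, hlim⟩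

/-- The support of the absolutely continuous part of a finite Borel measure `μ` on `ℝ`
coincides with the essential closure of the set of points where the boundary limit of the
imaginary part of the Borel transform exists and is positive (and finite). -/
theorem supp_ac_eq_clac (μ : Measure ℝ) [IsFiniteMeasure μ] :
    msupp (volume.withDensity (μ.rnDeriv volume)) =
      clac {x : ℝ | ∃ L : ℝ, 0 < L ∧
        Tendsto (fun y : ℝ => (borelTransform μ ((x : ℂ) + y * Complex.I)).im)
          (nhdsWithin 0 (Set.Ioi 0)) (nhds L)} := by
  ext x
  simp only [msupp, clac, mem_ofPred_eq]
  refine forall₂_congr fun ε _ => ?_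
  rw [pos_iff_ne_zero, pos_iff_ne_zero, Ne, Ne,
    withDensity_apply_eq_zero (μ.measurable_rnDeriv volume)]
  refine not_congr ?_
  rw [measure_congr]
  filter_upwards [ae_exists_pos_tendsto_borelTransform_im_iff μ] with t ht
  exact propext (and_comm.trans (and_congr_right' ht.symm))
end

section
/- Let μ be a finite Borel measure on ℝ with Borel transform F. Then for every x ∈ ℝ one has lim_{y↘0} y·F(x+iy) = i·μ({x}); in particular μ({x}) = 0 if and only if lim_{y↘0} y·F(x+iy) = 0. -/
open MeasureTheory Filter Complex Set

lemma abs_le_norm_ofReal_sub_add_mul_I (x y t : ℝ) :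
    |y| ≤ ‖(t : ℂ) - ((x : ℂ) + y * Complex.I)‖ := by
  simpa using Complex.abs_im_le_norm ((t : ℂ) - ((x : ℂ) + y * Complex.I))

lemma norm_mul_one_div_sub_le_one (x y t : ℝ) :
    ‖(y : ℂ) * (1 / ((t : ℂ) - ((x : ℂ) + y * Complex.I)))‖ ≤ 1 := by
  rw [mul_one_div, norm_div, Complex.norm_real, Real.norm_eq_abs]
  exact div_le_one_of_le₀ (abs_le_norm_ofReal_sub_add_mul_I x y t) (norm_nonneg _)

/-- The rescaled Cauchy kernel converges pointwise to `I` times the indicator of `{x}`. -/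
lemma tendsto_mul_one_div_sub (x t : ℝ) :
    Tendsto (fun y : ℝ => (y : ℂ) * (1 / ((t : ℂ) - ((x : ℂ) + y * Complex.I))))
      (nhdsWithin 0 (Set.Ioi 0)) (nhds (({x} : Set ℝ).indicator (fun _ => Complex.I) t)) := by
  by_cases h : t = x
  · subst h
    rw [Set.indicator_of_mem (Set.mem_singleton t)]
    refine tendsto_const_nhds.congr' ?_
    filter_upwards [self_mem_nhdsWithin] with y hy
    have hy' : (y : ℂ) ≠ 0 := Complex.ofReal_ne_zero.mpr (ne_of_gt hy)
    rw [sub_add_cancel_left, mul_one_div, div_neg, div_mul_cancel_left₀ hy', Complex.inv_I,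
      neg_neg]
  · rw [Set.indicator_of_notMem (by simpa using h)]
    have hne : (t : ℂ) - ((x : ℂ) + ((0 : ℝ) : ℂ) * Complex.I) ≠ 0 := by
      simpa [sub_eq_zero] using h
    have hc : ContinuousAt
        (fun y : ℝ => (y : ℂ) * (1 / ((t : ℂ) - ((x : ℂ) + y * Complex.I)))) 0 := by
      fun_prop (disch := exact hne)
    simpa using hc.tendsto.mono_left nhdsWithin_le_nhds

lemma tendsto_mul_borelTransform (μ : Measure ℝ) [IsFiniteMeasure μ] (x : ℝ) :
    Tendsto (fun y : ℝ => (y : ℂ) * borelTransform μ ((x : ℂ) + y * Complex.I))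
      (nhdsWithin 0 (Set.Ioi 0)) (nhds (Complex.I * ((μ {x}).toReal : ℂ))) := by
  have hlim : ∫ t, ({x} : Set ℝ).indicator (fun _ => Complex.I) t ∂μ
      = Complex.I * ((μ {x}).toReal : ℂ) := by
    rw [integral_indicator_const _ (measurableSet_singleton x), Measure.real, Complex.real_smul,
      mul_comm]
  simp only [borelTransform, ← integral_const_mul]
  rw [← hlim]
  refine tendsto_integral_filter_of_dominated_convergence (fun _ => 1) ?_ ?_
    (integrable_const 1) ?_
  · exact .of_forall fun y => Measurable.aestronglyMeasurable (by fun_prop)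
  · exact .of_forall fun y => .of_forall fun t => norm_mul_one_div_sub_le_one x y t
  · exact .of_forall fun t => tendsto_mul_one_div_sub x t

/-- For a finite Borel measure `μ` on `ℝ` and `x ∈ ℝ` one has
`lim_{y↘0} y·F(x+iy) = i·μ({x})`; in particular `μ({x}) = 0` iff this limit is `0`. -/
theorem point_mass_limit (μ : Measure ℝ) [IsFiniteMeasure μ] (x : ℝ) :
    Tendsto (fun y : ℝ => (y : ℂ) * borelTransform μ ((x : ℂ) + y * Complex.I))
      (nhdsWithin 0 (Set.Ioi 0)) (nhds (Complex.I * ((μ {x}).toReal : ℂ))) ∧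
    (μ {x} = 0 ↔
      Tendsto (fun y : ℝ => (y : ℂ) * borelTransform μ ((x : ℂ) + y * Complex.I))
        (nhdsWithin 0 (Set.Ioi 0)) (nhds 0)) := by
  have hF := tendsto_mul_borelTransform μ x
  refine ⟨hF, fun h => by simpa [h] using hF, fun h => ?_⟩
  have h0 := tendsto_nhds_unique hF h
  simpa [ENNReal.toReal_eq_zero_iff] using h0
end

section
/- Let μ be a finite Borel measure on ℝ with Borel transform F, and let μ_s be the singular part of μ in its Lebesgue decomposition with respect to Lebesgue measure. Then the set {x ∈ ℝ : Im F(x+iy) → +∞ as y ↘ 0} is a support for μ_s, that is, μ_s(ℝ \ {x ∈ ℝ : Im F(x+iy) → +∞ as y ↘ 0}) = 0. -/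
open MeasureTheory Filter Complex Set

theorem integrable_one_div_ofReal_sub (μ : Measure ℝ) [IsFiniteMeasure μ] {z : ℂ} (hz : 0 < z.im) :
    Integrable (fun t : ℝ => (1 : ℂ) / ((t : ℂ) - z)) μ := by
  refine Integrable.of_bound (C := 1 / z.im)
    (Measurable.aestronglyMeasurable (by fun_prop)) (ae_of_all _ fun t => ?_)
  rw [norm_div, norm_one]
  gcongr
  calc z.im = |((t : ℂ) - z).im| := by simp [abs_of_pos hz]
    _ ≤ ‖(t : ℂ) - z‖ := abs_im_le_norm _

/-- The imaginary part of the Cauchy kernel is the Poisson kernel. -/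
theorem im_one_div_ofReal_sub (t x y : ℝ) :
    ((1 : ℂ) / ((t : ℂ) - (x + y * I))).im = y / ((t - x) ^ 2 + y ^ 2) := by
  simp [normSq_apply, pow_two]

theorem im_borelTransform (μ : Measure ℝ) [IsFiniteMeasure μ] (x : ℝ) {y : ℝ} (hy : 0 < y) :
    (borelTransform μ (x + y * I)).im = ∫ t, y / ((t - x) ^ 2 + y ^ 2) ∂μ := by
  simp_rw [← im_one_div_ofReal_sub]
  exact (integral_im (integrable_one_div_ofReal_sub μ (by simpa using hy))).symm

theorem measureReal_closedBall_div_le_im_borelTransform (μ : Measure ℝ) [IsFiniteMeasure μ]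
    (x : ℝ) {y : ℝ} (hy : 0 < y) :
    μ.real (Metric.closedBall x y) / (2 * y) ≤ (borelTransform μ (x + y * I)).im := by
  have hint : Integrable (fun t : ℝ => y / ((t - x) ^ 2 + y ^ 2)) μ := by
    simp_rw [← im_one_div_ofReal_sub]
    exact (integrable_one_div_ofReal_sub μ (by simpa using hy)).im
  rw [im_borelTransform μ x hy]
  calc μ.real (Metric.closedBall x y) / (2 * y)
      = ∫ _ in Metric.closedBall x y, 1 / (2 * y) ∂μ := by
        rw [setIntegral_const, smul_eq_mul, mul_one_div]
    _ ≤ ∫ t in Metric.closedBall x y, y / ((t - x) ^ 2 + y ^ 2) ∂μ := by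
        refine setIntegral_mono_on (integrable_const _) hint.integrableOn
          Metric.isClosed_closedBall.measurableSet fun t ht => ?_
        rw [Metric.mem_closedBall, Real.dist_eq] at ht
        have hsq : (t - x) ^ 2 ≤ y ^ 2 := sq_le_sq' (abs_le.1 ht).1 (abs_le.1 ht).2
        rw [div_le_div_iff₀ (by positivity) (by positivity)]
        nlinarith
    _ ≤ ∫ t, y / ((t - x) ^ 2 + y ^ 2) ∂μ :=
        setIntegral_le_integral hint (ae_of_all _ fun t => by positivity)

/-- A measure singular with respect to Lebesgue measure has infinite symmetric derivative
almost everywhere. -/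
theorem MeasureTheory.Measure.MutuallySingular.ae_tendsto_closedBall_div_top
    {ν : Measure ℝ} [IsFiniteMeasure ν] (hν : ν ⟂ₘ volume) :
    ∀ᵐ x ∂ν, Tendsto (fun y : ℝ => ν (Metric.closedBall x y) / ENNReal.ofReal (2 * y))
      (nhdsWithin 0 (Set.Ioi 0)) (nhds ⊤) := by
  filter_upwards [Besicovitch.ae_tendsto_rnDeriv volume ν, hν.symm.rnDeriv_ae_eq_zero]
    with x hx hzero
  rw [hzero, Pi.zero_apply] at hx
  refine ENNReal.inv_zero ▸ hx.inv.congr' ?_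
  filter_upwards [self_mem_nhdsWithin] with y (hy : 0 < y)
  have hvol : ENNReal.ofReal (2 * y) ≠ 0 := by simpa using hy
  rw [Real.volume_closedBall, ENNReal.inv_div (Or.inr ENNReal.ofReal_ne_top) (Or.inr hvol)]

/-- The set of real points where `Im F(x+iy) → +∞` as `y ↘ 0` is a support for the singular
part of `μ` with respect to Lebesgue measure. -/
theorem singularPart_support (μ : Measure ℝ) [IsFiniteMeasure μ] :
    μ.singularPart volume
      ({x : ℝ |
        Tendsto (fun y : ℝ => (borelTransform μ ((x : ℂ) + y * Complex.I)).im)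
          (nhdsWithin 0 (Set.Ioi 0)) atTop}ᶜ) = 0 := by
  rw [← mem_ae_iff]
  filter_upwards [(μ.mutuallySingular_singularPart volume).ae_tendsto_closedBall_div_top] with x hx
  refine ENNReal.tendsto_ofReal_nhds_top.1 (tendsto_nhds_top_mono hx ?_)
  filter_upwards [self_mem_nhdsWithin] with y (hy : 0 < y)
  calc μ.singularPart volume (Metric.closedBall x y) / ENNReal.ofReal (2 * y)
      ≤ μ (Metric.closedBall x y) / ENNReal.ofReal (2 * y) := by
        gcongr
        exact μ.singularPart_le volume
    _ = ENNReal.ofReal (μ.real (Metric.closedBall x y) / (2 * y)) := by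
        rw [ENNReal.ofReal_div_of_pos (by positivity), ofReal_measureReal]
    _ ≤ ENNReal.ofReal (borelTransform μ (x + y * I)).im :=
        ENNReal.ofReal_le_ofReal (measureReal_closedBall_div_le_im_borelTransform μ x hy)
end

section
/- Let μ be a finite Borel measure on ℝ with Borel transform F. Then the set {x ∈ ℝ : Im F(x+iy) → +∞ as y ↘ 0} has Lebesgue measure zero. -/
open MeasureTheory Filter Complex Set

/-- A finite measure on `ℝ` has finite upper density with respect to Lebesgue measure almost
everywhere, and the corresponding bound can be taken uniform over all radii. -/
theorem ae_exists_measure_closedBall_le (μ : Measure ℝ) [IsFiniteMeasure μ] :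
    ∀ᵐ x : ℝ, ∃ C : NNReal, ∀ r : ℝ, 0 < r →
      μ (Metric.closedBall x r) ≤ C * ENNReal.ofReal r := by
  filter_upwards [Besicovitch.ae_tendsto_rnDeriv μ volume, μ.rnDeriv_lt_top volume] with x hx hlt
  obtain ⟨c, hc, -⟩ := ENNReal.lt_iff_exists_nnreal_btwn.1 hlt
  have hev := hx.eventually (gt_mem_nhds hc)
  obtain ⟨δ, hδ, hball⟩ := mem_nhdsGT_iff_exists_Ioo_subset.1 hev
  have hδ0 : 0 < δ := hδ
  refine ⟨max (2 * c) (μ.real univ / δ).toNNReal, fun r hr ↦ ?_⟩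
  rcases lt_or_ge r δ with h | h
  · have h1 : μ (Metric.closedBall x r) / volume (Metric.closedBall x r) < c := hball ⟨hr, h⟩
    rw [Real.volume_closedBall] at h1
    have h2 := (ENNReal.div_le_iff (by simpa using hr) ENNReal.ofReal_ne_top).1 h1.le
    calc μ (Metric.closedBall x r) ≤ c * ENNReal.ofReal (2 * r) := h2
      _ = (2 * c : NNReal) * ENNReal.ofReal r := by
        rw [ENNReal.ofReal_mul zero_le_two]
        push_cast
        rw [ENNReal.ofReal_ofNat]
        ring
      _ ≤ _ := by gcongr; exact le_max_left _ _
  · calc μ (Metric.closedBall x r) ≤ μ univ := measure_mono (subset_univ _)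
      _ = ENNReal.ofReal (μ.real univ / δ * δ) := by
        rw [div_mul_cancel₀ _ hδ0.ne', ofReal_measureReal]
      _ = (μ.real univ / δ).toNNReal * ENNReal.ofReal δ := by
        rw [ENNReal.ofReal_mul (by positivity)]; rfl
      _ ≤ _ := by gcongr; exact le_max_right _ _

/-- Pointwise bound of the Poisson kernel by a sum of indicators of dyadic balls. -/
theorem ofReal_poisson_le_tsum_indicator {y : ℝ} (hy : 0 < y) (x t : ℝ) :
    ENNReal.ofReal (y / ((t - x) ^ 2 + y ^ 2)) ≤
      ∑' k : ℕ, (Metric.closedBall x (2 ^ k * y)).indicator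
        (fun _ ↦ ENNReal.ofReal (4 * (1 / 4) ^ k / y)) t := by
  classical
  have hex : ∃ k : ℕ, |t - x| ≤ 2 ^ k * y := by
    obtain ⟨k, hk⟩ := pow_unbounded_of_one_lt (|t - x| / y) (one_lt_two)
    exact ⟨k, (div_le_iff₀ hy).1 hk.le⟩
  have hmem : t ∈ Metric.closedBall x (2 ^ Nat.find hex * y) := by
    rw [Metric.mem_closedBall, Real.dist_eq]
    exact Nat.find_spec hex
  refine le_trans ?_ (ENNReal.le_tsum (Nat.find hex))
  rw [indicator_of_mem hmem]
  apply ENNReal.ofReal_le_ofReal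
  rcases hk : Nat.find hex with _ | k
  · rw [div_le_div_iff₀ (by positivity) hy]
    nlinarith [sq_nonneg (t - x), sq_nonneg y]
  · have hlt : 2 ^ k * y < |t - x| := not_le.1 (Nat.find_min hex (by omega))
    have hsq : (2 ^ k * y) ^ 2 ≤ (t - x) ^ 2 := by
      rw [← sq_abs (t - x)]
      gcongr
    have hpow : ((1 : ℝ) / 4) ^ k * (2 ^ k) ^ 2 = 1 := by
      rw [← pow_mul, mul_comm k 2, pow_mul, ← mul_pow]
      norm_num
    rw [div_le_div_iff₀ (by positivity) hy, pow_succ]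
    calc y * y = (1 / 4) ^ k * (2 ^ k * y) ^ 2 := by
          rw [mul_pow, ← mul_assoc, hpow]; ring
      _ ≤ (1 / 4) ^ k * ((t - x) ^ 2 + y ^ 2) := by
          gcongr
          nlinarith [sq_nonneg y]
      _ = _ := by ring

/-- If `μ (closedBall x r) ≤ C * r` for all `r`, the Poisson integrals of `μ` at `x` are
bounded. -/
theorem lintegral_poisson_le {μ : Measure ℝ} {x : ℝ} {C : NNReal}
    (hC : ∀ r : ℝ, 0 < r → μ (Metric.closedBall x r) ≤ C * ENNReal.ofReal r)
    {y : ℝ} (hy : 0 < y) :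
    ∫⁻ t, ENNReal.ofReal (y / ((t - x) ^ 2 + y ^ 2)) ∂μ ≤ ENNReal.ofReal (8 * C) := by
  calc ∫⁻ t, ENNReal.ofReal (y / ((t - x) ^ 2 + y ^ 2)) ∂μ
      ≤ ∫⁻ t, ∑' k : ℕ, (Metric.closedBall x (2 ^ k * y)).indicator
          (fun _ ↦ ENNReal.ofReal (4 * (1 / 4) ^ k / y)) t ∂μ :=
        lintegral_mono (ofReal_poisson_le_tsum_indicator hy x)
    _ = ∑' k : ℕ, ENNReal.ofReal (4 * (1 / 4) ^ k / y) *
          μ (Metric.closedBall x (2 ^ k * y)) := by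
        rw [lintegral_tsum fun k ↦
          (measurable_const.indicator Metric.isClosed_closedBall.measurableSet).aemeasurable]
        simp_rw [lintegral_indicator_const Metric.isClosed_closedBall.measurableSet]
    _ ≤ ∑' k : ℕ, ENNReal.ofReal (4 * C * (1 / 2) ^ k) := by
        refine ENNReal.tsum_le_tsum fun k ↦ ?_
        calc _ ≤ ENNReal.ofReal (4 * (1 / 4) ^ k / y) *
              (C * ENNReal.ofReal (2 ^ k * y)) := by
              gcongr
              exact hC _ (by positivity)
          _ = ENNReal.ofReal (4 * (1 / 4) ^ k / y * (C * (2 ^ k * y))) := by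
              rw [ENNReal.ofReal_mul (p := 4 * (1 / 4) ^ k / y) (by positivity),
                ENNReal.ofReal_mul C.coe_nonneg, ENNReal.ofReal_coe_nnreal]
          _ = _ := by
              congr 1
              rw [show ((1 : ℝ) / 2) ^ k = (1 / 4) ^ k * 2 ^ k by rw [← mul_pow]; norm_num]
              field_simp
    _ = ENNReal.ofReal (8 * C) := by
        have hs := hasSum_geometric_two.mul_left (4 * (C : ℝ))
        rw [← ENNReal.ofReal_tsum_of_nonneg (fun k ↦ by positivity) hs.summable, hs.tsum_eq]
        congr 1
        ring

/-- The imaginary part of the Cauchy kernel is the Poisson kernel. -/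
theorem im_one_div_sub_add_mul_I (x y t : ℝ) :
    ((1 : ℂ) / ((t : ℂ) - ((x : ℂ) + y * I))).im = y / ((t - x) ^ 2 + y ^ 2) := by
  rw [one_div, inv_im, normSq_apply]
  simp
  ring

/-- If `μ (closedBall x r) ≤ C * r` for all `r`, the imaginary part of the Borel transform of `μ`
is bounded on the vertical half-line above `x`. -/
theorem borelTransform_im_le {μ : Measure ℝ} {x : ℝ} {C : NNReal}
    (hC : ∀ r : ℝ, 0 < r → μ (Metric.closedBall x r) ≤ C * ENNReal.ofReal r)
    {y : ℝ} (hy : 0 < y) :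
    (borelTransform μ ((x : ℂ) + y * I)).im ≤ 8 * C := by
  unfold borelTransform
  by_cases hint : Integrable (fun t : ℝ ↦ (1 : ℂ) / ((t : ℂ) - ((x : ℂ) + y * I))) μ
  · have him : (∫ t : ℝ, (1 : ℂ) / ((t : ℂ) - ((x : ℂ) + y * I)) ∂μ).im =
        ∫ t : ℝ, y / ((t - x) ^ 2 + y ^ 2) ∂μ := by
      simp_rw [← im_one_div_sub_add_mul_I]
      exact (imCLM.integral_comp_comm hint).symm
    rw [him, integral_eq_lintegral_of_nonneg_ae (ae_of_all _ fun t ↦ by positivity)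
      (Measurable.aestronglyMeasurable (by fun_prop))]
    exact ENNReal.toReal_le_of_le_ofReal (by positivity) (lintegral_poisson_le hC hy)
  · rw [integral_undef hint, zero_im]
    positivity

/-- The set of real points where `Im F(x+iy) → +∞` as `y ↘ 0` has Lebesgue measure zero. -/
theorem measure_zero_of_im_tendsto_atTop (μ : Measure ℝ) [IsFiniteMeasure μ] :
    volume
      {x : ℝ |
        Tendsto (fun y : ℝ => (borelTransform μ ((x : ℂ) + y * Complex.I)).im)
          (nhdsWithin 0 (Set.Ioi 0)) atTop} = 0 := by
  rw [measure_eq_zero_iff_ae_notMem]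
  filter_upwards [ae_exists_measure_closedBall_le μ] with x ⟨C, hC⟩ hx
  obtain ⟨y, hgt, hy⟩ :=
    ((hx.eventually (eventually_gt_atTop (8 * (C : ℝ)))).and self_mem_nhdsWithin).exists
  exact (borelTransform_im_le hC hy).not_gt hgt
end

section
/- Let μ be a finite Borel measure on ℝ with Borel transform F, and let a < b be real numbers with μ({a}) = μ({b}) = 0. Then lim_{δ↘0} (1/(2πi)) ∫_a^b (F(t + iδ) − F(t − iδ)) dt = μ((a, b)). -/
open MeasureTheory Filter Complex Set Real

theorem poissonKernel_le_inv {δ : ℝ} (hδ : 0 < δ) (u : ℝ) : δ / (δ ^ 2 + u ^ 2) ≤ δ⁻¹ := by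
  rw [div_le_iff₀ (by positivity), inv_mul_eq_div, le_div_iff₀ hδ]
  nlinarith [sq_nonneg u]

theorem integrable_one_div_sub (μ : Measure ℝ) [IsFiniteMeasure μ] {z : ℂ} (hz : z.im ≠ 0) :
    Integrable (fun x : ℝ => (1 : ℂ) / ((x : ℂ) - z)) μ := by
  refine Integrable.of_bound (C := |z.im|⁻¹) (Measurable.aestronglyMeasurable (by fun_prop))
    (.of_forall fun x => ?_)
  rw [norm_div, norm_one, one_div]
  gcongr
  simpa using Complex.abs_im_le_norm ((x : ℂ) - z)

theorem one_div_sub_sub_one_div_sub {δ : ℝ} (hδ : 0 < δ) (x t : ℝ) :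
    (1 : ℂ) / ((x : ℂ) - ((t : ℂ) + δ * I)) - 1 / ((x : ℂ) - ((t : ℂ) - δ * I)) =
      2 * I * ((δ / (δ ^ 2 + (t - x) ^ 2) : ℝ) : ℂ) := by
  have h₁ : (x : ℂ) - ((t : ℂ) + δ * I) ≠ 0 := fun h => hδ.ne' (by simpa using congrArg im h)
  have h₂ : (x : ℂ) - ((t : ℂ) - δ * I) ≠ 0 := fun h => hδ.ne' (by simpa using congrArg im h)
  have h₃ : ((x : ℂ) - ((t : ℂ) + δ * I)) * ((x : ℂ) - ((t : ℂ) - δ * I)) =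
      (δ : ℂ) ^ 2 + ((t : ℂ) - x) ^ 2 := by
    linear_combination -(δ : ℂ) ^ 2 * I_sq
  push_cast
  rw [div_sub_div _ _ h₁ h₂, h₃]
  ring

theorem borelTransform_sub (μ : Measure ℝ) [IsFiniteMeasure μ] {δ : ℝ} (hδ : 0 < δ) (t : ℝ) :
    borelTransform μ ((t : ℂ) + δ * I) - borelTransform μ ((t : ℂ) - δ * I) =
      2 * I * ((∫ x, δ / (δ ^ 2 + (t - x) ^ 2) ∂μ : ℝ) : ℂ) := by
  unfold borelTransform
  rw [← integral_sub (integrable_one_div_sub μ (by simpa using hδ.ne'))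
    (integrable_one_div_sub μ (by simpa using hδ.ne'))]
  simp_rw [one_div_sub_sub_one_div_sub hδ]
  rw [integral_const_mul, integral_complex_ofReal]

theorem intervalIntegral_integral_poissonKernel (μ : Measure ℝ) [IsFiniteMeasure μ] (a b : ℝ)
    {δ : ℝ} (hδ : 0 < δ) :
    ∫ t in a..b, ∫ x, δ / (δ ^ 2 + (t - x) ^ 2) ∂μ =
      ∫ x, (Real.arctan ((b - x) / δ) - Real.arctan ((a - x) / δ)) ∂μ := by
  rw [intervalIntegral_integral_swap]
  · congr 1 with x
    rw [intervalIntegral.integral_comp_sub_right (fun u => δ / (δ ^ 2 + u ^ 2)),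
      integral_div_sq_add_sq]
  · have : IsFiniteMeasure (volume.restrict (uIoc a b)) := ⟨by simp [uIoc]⟩
    refine Integrable.of_bound (C := δ⁻¹) (Measurable.aestronglyMeasurable ?_)
      (.of_forall fun p => ?_)
    · unfold Function.uncurry
      fun_prop
    · rw [Function.uncurry, Real.norm_of_nonneg (by positivity)]
      exact poissonKernel_le_inv hδ _

theorem tendsto_arctan_div_of_pos {c : ℝ} (hc : 0 < c) :
    Tendsto (fun δ : ℝ => Real.arctan (c / δ)) (nhdsWithin 0 (Ioi 0)) (nhds (π / 2)) :=
  (tendsto_arctan_atTop.mono_right nhdsWithin_le_nhds).comp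
    ((tendsto_inv_nhdsGT_zero.const_mul_atTop hc).congr fun δ => (div_eq_mul_inv c δ).symm)

theorem tendsto_arctan_div_of_neg {c : ℝ} (hc : c < 0) :
    Tendsto (fun δ : ℝ => Real.arctan (c / δ)) (nhdsWithin 0 (Ioi 0)) (nhds (-(π / 2))) := by
  simpa [neg_div, arctan_neg] using (tendsto_arctan_div_of_pos (neg_pos.2 hc)).neg

theorem tendsto_integral_arctan_sub_arctan (μ : Measure ℝ) [IsFiniteMeasure μ] {a b : ℝ}
    (hab : a < b) (ha : μ {a} = 0) (hb : μ {b} = 0) :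
    Tendsto (fun δ : ℝ => ∫ x, (Real.arctan ((b - x) / δ) - Real.arctan ((a - x) / δ)) ∂μ)
      (nhdsWithin 0 (Ioi 0)) (nhds (μ.real (Ioo a b) * π)) := by
  rw [← smul_eq_mul, ← integral_indicator_const π measurableSet_Ioo]
  refine tendsto_integral_filter_of_dominated_convergence (fun _ => π)
    (.of_forall fun δ => Measurable.aestronglyMeasurable (by fun_prop))
    (.of_forall fun δ => .of_forall fun x => ?_) (integrable_const _) ?_
  · rw [Real.norm_eq_abs, abs_le]
    constructor <;>
    linarith [arctan_lt_pi_div_two ((b - x) / δ), neg_pi_div_two_lt_arctan ((b - x) / δ),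
      arctan_lt_pi_div_two ((a - x) / δ), neg_pi_div_two_lt_arctan ((a - x) / δ)]
  · filter_upwards [measure_eq_zero_iff_ae_notMem.1 ha, measure_eq_zero_iff_ae_notMem.1 hb]
      with x hxa hxb
    rcases lt_or_gt_of_ne (show x ≠ a from hxa) with h | h
    · rw [indicator_of_notMem fun hx => h.not_gt hx.1]
      simpa using (tendsto_arctan_div_of_pos (sub_pos.2 (h.trans hab))).sub
        (tendsto_arctan_div_of_pos (sub_pos.2 h))
    rcases lt_or_gt_of_ne (show x ≠ b from hxb) with h' | h'
    · rw [indicator_of_mem (show x ∈ Ioo a b from ⟨h, h'⟩)]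
      simpa using (tendsto_arctan_div_of_pos (sub_pos.2 h')).sub
        (tendsto_arctan_div_of_neg (sub_neg.2 h))
    · rw [indicator_of_notMem fun hx => h'.not_gt hx.2]
      simpa using (tendsto_arctan_div_of_neg (sub_neg.2 h')).sub
        (tendsto_arctan_div_of_neg (sub_neg.2 h))


/-- Stone's formula: for a finite Borel measure `μ` with `μ({a}) = μ({b}) = 0` and `a < b`,
`lim_{δ↘0} (1/(2πi)) ∫_a^b (F(t+iδ) − F(t−iδ)) dt = μ((a,b))`. -/
theorem stone_formula (μ : Measure ℝ) [IsFiniteMeasure μ] (a b : ℝ) (hab : a < b)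
    (ha : μ {a} = 0) (hb : μ {b} = 0) :
    Tendsto
      (fun δ : ℝ => (1 / (2 * (Real.pi : ℂ) * Complex.I)) *
        ∫ t in a..b,
          (borelTransform μ ((t : ℂ) + δ * Complex.I) -
            borelTransform μ ((t : ℂ) - δ * Complex.I)))
      (nhdsWithin 0 (Set.Ioi 0)) (nhds (((μ (Set.Ioo a b)).toReal : ℂ))) := by
  have hlim := (continuous_ofReal.tendsto _).comp
    ((tendsto_integral_arctan_sub_arctan μ hab ha hb).div_const π)
  rw [mul_div_cancel_right₀ _ pi_ne_zero] at hlim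
  refine hlim.congr' ?_
  filter_upwards [self_mem_nhdsWithin] with δ hδ
  simp_rw [borelTransform_sub μ hδ]
  rw [intervalIntegral.integral_const_mul, intervalIntegral.integral_ofReal,
    intervalIntegral_integral_poissonKernel μ a b hδ, Function.comp_apply, ofReal_div]
  have hπ : (π : ℂ) ≠ 0 := ofReal_ne_zero.2 pi_ne_zero
  field_simp
end
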